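/- arXiv:1802.05111 — 3 statements merged into one kernel-verified Lean document; each statement's English description precedes it below -/
import Mathlib

section
/- Let V be a smooth function compactly supported in (0,∞) all of whose derivatives are bounded. For every ε > 0 and every A ≥ 1 there is a constant C = C(A, ε, V) such that the following holds: for all real t ≥ 2, all reals N, M ≥ 1, all positive integers p, ℓ, all positive integers n with n ≤ 2N, and every nonzero integer r with |r| ≥ t^ε · M² t² ℓ / (Np), one has | ∫_ℝ x^{−it} e(−nt/(Nx)) V(x) e(−rNpx/(M²ℓt)) dx | ≤ C · t^{−A}. -/
open Complex MeasureTheory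

/-- `e(x) = exp(2πix)`. -/
noncomputable def e (x : ℝ) : ℂ := Complex.exp (2 * Real.pi * Complex.I * x)

/-- `x^{-it}` for `x > 0`, i.e. `exp(−it·log x)`. -/
noncomputable def nit (x t : ℝ) : ℂ := Complex.exp (-(Complex.I * (t : ℂ)) * (Real.log x : ℂ))

open Set Filter Topology

lemma norm_e (x : ℝ) : ‖e x‖ = 1 := by
  have h : (2 * Real.pi * Complex.I * x : ℂ) = ((2 * Real.pi * x : ℝ) : ℂ) * Complex.I := by
    push_cast; ring
  rw [e, h, Complex.norm_exp_ofReal_mul_I]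

lemma norm_nit (x t : ℝ) : ‖nit x t‖ = 1 := by
  have h : (-(Complex.I * (t : ℂ)) * (Real.log x : ℂ) : ℂ)
      = ((-(t * Real.log x) : ℝ) : ℂ) * Complex.I := by
    push_cast; ring
  rw [nit, h, Complex.norm_exp_ofReal_mul_I]

lemma hasDerivAt_e_comp {f : ℝ → ℝ} {f' x : ℝ} (hf : HasDerivAt f f' x) :
    HasDerivAt (fun y => e (f y)) (e (f x) * (2 * Real.pi * Complex.I * f')) x := by
  unfold e
  exact (hf.ofReal_comp.const_mul _).cexp

lemma hasDerivAt_nit {x : ℝ} (hx : 0 < x) (t : ℝ) :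
    HasDerivAt (fun y => nit y t) (nit x t * (-(Complex.I * t) * (x : ℂ)⁻¹)) x := by
  unfold nit
  have h := ((Real.hasDerivAt_log hx.ne').ofReal_comp.const_mul (-(Complex.I * (t : ℂ)))).cexp
  simpa using h

/-- The oscillatory factor `x^{-it} e(-at/x) e(-Rx)`. -/
noncomputable def oscFactor (t a R x : ℝ) : ℂ :=
  nit x t * e (-(a * t) / x) * e (-(R * x))

lemma norm_oscFactor (t a R x : ℝ) : ‖oscFactor t a R x‖ = 1 := by
  simp [oscFactor, norm_e, norm_nit]

lemma hasDerivAt_oscFactor {x : ℝ} (hx : 0 < x) (t a R : ℝ) :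
    HasDerivAt (oscFactor t a R)
      (oscFactor t a R x * (-(Complex.I * t) * (x : ℂ)⁻¹
        + 2 * Real.pi * Complex.I * a * t * (x : ℂ)⁻¹ ^ 2 - 2 * Real.pi * Complex.I * R)) x := by
  have h1 : HasDerivAt (fun y : ℝ => -(a * t) / y) (a * t * x⁻¹ ^ 2) x := by
    have := (hasDerivAt_inv hx.ne').const_mul (-(a * t))
    simp only [div_eq_mul_inv]
    refine this.congr_deriv ?_
    rw [inv_pow]; ring
  have h2 : HasDerivAt (fun y : ℝ => -(R * y)) (-R) x := by
    have := (hasDerivAt_id x).const_mul (-R)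
    simpa using this
  have h := ((hasDerivAt_nit hx t).mul (hasDerivAt_e_comp h1)).mul (hasDerivAt_e_comp h2)
  refine h.congr_deriv ?_
  simp only [oscFactor, Pi.mul_apply]
  push_cast
  ring

lemma iteratedDeriv_eq_zero_of_nonpos {V : ℝ → ℂ} (hV : ContDiff ℝ (⊤ : ℕ∞) V)
    (hsupp : Function.support V ⊆ Ioi 0) (j : ℕ) {x : ℝ} (hx : x ≤ 0) :
    iteratedDeriv j V x = 0 := by
  have hc : Continuous (iteratedDeriv j V) :=
    hV.continuous_iteratedDeriv j (by exact_mod_cast le_top)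
  have hneg : EqOn (iteratedDeriv j V) 0 (Iio 0) := by
    intro y hy
    have h : V =ᶠ[𝓝 y] fun _ => 0 := by
      filter_upwards [Iio_mem_nhds hy] with z hz
      by_contra hne
      exact lt_asymm (mem_Iio.1 hz) (mem_Ioi.1 (hsupp hne))
    have := h.iteratedDeriv_eq j
    simpa using this
  have := hneg.closure hc continuous_const
  rw [closure_Iio] at this
  exact this hx

lemma hasDerivAt_iteratedDeriv {V : ℝ → ℂ} (hV : ContDiff ℝ (⊤ : ℕ∞) V) (j : ℕ) (x : ℝ) :
    HasDerivAt (iteratedDeriv j V) (iteratedDeriv (j + 1) V x) x := by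
  rw [iteratedDeriv_succ]
  exact ((hV.differentiable_iteratedDeriv j (by exact_mod_cast WithTop.coe_lt_top _)) x).hasDerivAt

/-- A smooth function vanishing on the negative half-line is flat at the origin. -/
lemma exists_norm_iteratedDeriv_le_mul_pow {V : ℝ → ℂ} (hV : ContDiff ℝ (⊤ : ℕ∞) V)
    (hsupp : Function.support V ⊆ Ioi 0)
    (hder : ∀ j : ℕ, ∃ Cj : ℝ, ∀ x : ℝ, ‖iteratedDeriv j V x‖ ≤ Cj) (m : ℕ) :
    ∀ j : ℕ, ∃ C : ℝ, 0 ≤ C ∧ ∀ x : ℝ, 0 < x → ‖iteratedDeriv j V x‖ ≤ C * x ^ m := by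
  induction m with
  | zero =>
    intro j
    obtain ⟨C, hC⟩ := hder j
    exact ⟨C, (norm_nonneg _).trans (hC 0), fun x _ => by simpa using hC x⟩
  | succ m ih =>
    intro j
    obtain ⟨C, hC0, hC⟩ := ih (j + 1)
    refine ⟨C, hC0, fun x hx => ?_⟩
    have h0 : ∀ k, iteratedDeriv k V 0 = 0 := fun k =>
      iteratedDeriv_eq_zero_of_nonpos hV hsupp k le_rfl
    have h := (convex_Icc (0 : ℝ) x).norm_image_sub_le_of_norm_hasDerivWithin_le
      (f := iteratedDeriv j V) (f' := iteratedDeriv (j + 1) V) (C := C * x ^ m)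
      (fun y _ => (hasDerivAt_iteratedDeriv hV j y).hasDerivWithinAt)
      (fun y hy => by
        rcases hy.1.eq_or_lt with rfl | hy0
        · rw [h0, norm_zero]; positivity
        · refine (hC y hy0).trans ?_
          have := hy.2
          gcongr)
      (left_mem_Icc.2 hx.le) (right_mem_Icc.2 hx.le)
    rw [h0, sub_zero, sub_zero, Real.norm_of_nonneg hx.le] at h
    rw [pow_succ, ← mul_assoc]
    exact h

/-- The integrand `x^{-it} e(-at/x) e(-Rx) V^{(j)}(x) x^{-m}`. -/
noncomputable def oscIntegrand (V : ℝ → ℂ) (t a R : ℝ) (j m : ℕ) (x : ℝ) : ℂ :=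
  oscFactor t a R x * iteratedDeriv j V x * (x : ℂ)⁻¹ ^ m

lemma hasDerivAt_oscIntegrand {V : ℝ → ℂ} (hV : ContDiff ℝ (⊤ : ℕ∞) V) (t a R : ℝ) (j m : ℕ)
    {x : ℝ} (hx : 0 < x) :
    HasDerivAt (oscIntegrand V t a R j m)
      (oscIntegrand V t a R (j + 1) m x
        - (m + Complex.I * t) * oscIntegrand V t a R j (m + 1) x
        + 2 * Real.pi * Complex.I * a * t * oscIntegrand V t a R j (m + 2) x
        - 2 * Real.pi * Complex.I * R * oscIntegrand V t a R j m x) x := by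
  have hx' : (x : ℂ) ≠ 0 := by exact_mod_cast hx.ne'
  have h1 : HasDerivAt (fun y : ℝ => (y : ℂ)⁻¹ ^ m) (-m * (x : ℂ)⁻¹ ^ (m + 1)) x := by
    have h := (((hasDerivAt_inv hx').pow m)).comp_ofReal
    refine h.congr_deriv ?_
    rcases m with _ | m
    · simp
    · rw [Nat.add_sub_cancel, ← inv_pow]
      ring
  have h := ((hasDerivAt_oscFactor hx t a R).mul (hasDerivAt_iteratedDeriv hV j x)).mul h1
  refine h.congr_deriv ?_
  simp only [oscIntegrand, Pi.mul_apply]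
  ring

lemma exists_norm_oscIntegrand_le {V : ℝ → ℂ} (hV : ContDiff ℝ (⊤ : ℕ∞) V)
    (hsupp : Function.support V ⊆ Ioi 0)
    (hder : ∀ j : ℕ, ∃ Cj : ℝ, ∀ x : ℝ, ‖iteratedDeriv j V x‖ ≤ Cj) (j m i : ℕ) :
    ∃ C : ℝ, 0 ≤ C ∧ ∀ t a R x : ℝ, 0 < x → ‖oscIntegrand V t a R j m x‖ ≤ C * x ^ i := by
  obtain ⟨C, hC0, hC⟩ := exists_norm_iteratedDeriv_le_mul_pow hV hsupp hder (m + i) j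
  refine ⟨C, hC0, fun t a R x hx => ?_⟩
  rw [oscIntegrand, norm_mul, norm_mul, norm_oscFactor, one_mul, norm_pow, norm_inv,
    Complex.norm_real, Real.norm_of_nonneg hx.le, inv_pow, ← div_eq_mul_inv,
    div_le_iff₀ (by positivity)]
  refine (hC x hx).trans_eq ?_
  ring

lemma exists_forall_iteratedDeriv_eq_zero {V : ℝ → ℂ} (hcs : HasCompactSupport V) :
    ∃ B : ℝ, ∀ j : ℕ, ∀ x : ℝ, B < x → iteratedDeriv j V x = 0 := by
  obtain ⟨B, hB⟩ := hcs.isCompact.bddAbove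
  refine ⟨B, fun j x hx => ?_⟩
  have h : V =ᶠ[𝓝 x] fun _ => 0 := by
    filter_upwards [Ioi_mem_nhds hx] with z hz
    exact image_eq_zero_of_notMem_tsupport fun hmem => (not_lt.2 (hB hmem)) hz
  simpa using h.iteratedDeriv_eq j

lemma continuousOn_oscIntegrand {V : ℝ → ℂ} (hV : ContDiff ℝ (⊤ : ℕ∞) V) (t a R : ℝ) (j m : ℕ) :
    ContinuousOn (oscIntegrand V t a R j m) (Ioi 0) := fun _ hx =>
  (hasDerivAt_oscIntegrand hV t a R j m hx).continuousAt.continuousWithinAt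

lemma exists_integrableOn_and_norm_integral_oscIntegrand_le {V : ℝ → ℂ}
    (hV : ContDiff ℝ (⊤ : ℕ∞) V) (hcs : HasCompactSupport V)
    (hsupp : Function.support V ⊆ Ioi 0)
    (hder : ∀ j : ℕ, ∃ Cj : ℝ, ∀ x : ℝ, ‖iteratedDeriv j V x‖ ≤ Cj) (j m : ℕ) :
    ∃ C : ℝ, 0 ≤ C ∧ ∀ t a R : ℝ, IntegrableOn (oscIntegrand V t a R j m) (Ioi 0) ∧
      ‖∫ x in Ioi 0, oscIntegrand V t a R j m x‖ ≤ C := by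
  obtain ⟨C, hC0, hC⟩ := exists_norm_oscIntegrand_le hV hsupp hder j m 0
  obtain ⟨B, hB⟩ := exists_forall_iteratedDeriv_eq_zero hcs
  have hg : Integrable ((Ioc 0 B).indicator fun _ : ℝ => C) (volume.restrict (Ioi 0)) :=
    ((integrable_indicator_iff measurableSet_Ioc).2
      (integrableOn_const (by simp))).integrableOn
  have hle : ∀ t a R : ℝ, ∀ᵐ x ∂(volume.restrict (Ioi (0 : ℝ))),
      ‖oscIntegrand V t a R j m x‖ ≤ (Ioc 0 B).indicator (fun _ : ℝ => C) x := by
    intro t a R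
    filter_upwards [ae_restrict_mem measurableSet_Ioi] with x hx
    by_cases hxB : x ≤ B
    · rw [indicator_of_mem (show x ∈ Ioc 0 B from ⟨hx, hxB⟩)]
      simpa using hC t a R x hx
    · rw [indicator_of_notMem (fun h => hxB h.2), oscIntegrand, hB j x (not_le.1 hxB)]
      simp
  refine ⟨∫ x in Ioi 0, (Ioc 0 B).indicator (fun _ : ℝ => C) x,
    integral_nonneg fun x => indicator_nonneg (fun _ _ => hC0) x, fun t a R => ⟨?_, ?_⟩⟩
  · exact hg.mono' ((continuousOn_oscIntegrand hV t a R j m).aestronglyMeasurable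
      measurableSet_Ioi) (hle t a R)
  · exact norm_integral_le_of_norm_le hg (hle t a R)

lemma integral_oscIntegrand_by_parts {V : ℝ → ℂ}
    (hV : ContDiff ℝ (⊤ : ℕ∞) V) (hcs : HasCompactSupport V)
    (hsupp : Function.support V ⊆ Ioi 0)
    (hder : ∀ j : ℕ, ∃ Cj : ℝ, ∀ x : ℝ, ‖iteratedDeriv j V x‖ ≤ Cj) (t a R : ℝ) (j m : ℕ) :
    2 * Real.pi * Complex.I * R * ∫ x in Ioi 0, oscIntegrand V t a R j m x
      = (∫ x in Ioi 0, oscIntegrand V t a R (j + 1) m x)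
        - (m + Complex.I * t) * (∫ x in Ioi 0, oscIntegrand V t a R j (m + 1) x)
        + 2 * Real.pi * Complex.I * a * t * ∫ x in Ioi 0, oscIntegrand V t a R j (m + 2) x := by
  have hint : ∀ j m, IntegrableOn (oscIntegrand V t a R j m) (Ioi 0) := fun j m => by
    obtain ⟨_, _, h⟩ :=
      exists_integrableOn_and_norm_integral_oscIntegrand_le hV hcs hsupp hder j m
    exact (h t a R).1
  have h0 : oscIntegrand V t a R j m 0 = 0 := by
    simp [oscIntegrand, iteratedDeriv_eq_zero_of_nonpos hV hsupp j le_rfl]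
  have hcont : ContinuousWithinAt (oscIntegrand V t a R j m) (Ici 0) 0 := by
    obtain ⟨C, hC0, hC⟩ := exists_norm_oscIntegrand_le hV hsupp hder j m 1
    rw [ContinuousWithinAt, h0]
    have hlim : Tendsto (fun x : ℝ => C * x ^ 1) (𝓝[≥] 0) (𝓝 0) := by
      have : Continuous fun x : ℝ => C * x ^ 1 := by fun_prop
      simpa using (this.tendsto 0).mono_left nhdsWithin_le_nhds
    refine squeeze_zero_norm' ?_ hlim
    filter_upwards [self_mem_nhdsWithin] with x hx
    rcases (mem_Ici.1 hx).eq_or_lt with rfl | hx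
    · simp [h0]
    · exact hC t a R x hx
  have htop : Tendsto (oscIntegrand V t a R j m) atTop (𝓝 0) := by
    obtain ⟨B, hB⟩ := exists_forall_iteratedDeriv_eq_zero hcs
    refine tendsto_const_nhds.congr' ?_
    filter_upwards [eventually_gt_atTop B] with x hx
    simp [oscIntegrand, hB j x hx]
  have i1 := hint (j + 1) m
  have i2 := (hint j (m + 1)).const_mul (m + Complex.I * t)
  have i3 := (hint j (m + 2)).const_mul (2 * Real.pi * Complex.I * a * t)
  have i4 := (hint j m).const_mul (2 * Real.pi * Complex.I * R)
  have i12 : Integrable (fun x => oscIntegrand V t a R (j + 1) m x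
      - (m + Complex.I * t) * oscIntegrand V t a R j (m + 1) x) (volume.restrict (Ioi 0)) :=
    i1.sub i2
  have i123 : Integrable (fun x => oscIntegrand V t a R (j + 1) m x
      - (m + Complex.I * t) * oscIntegrand V t a R j (m + 1) x
      + 2 * Real.pi * Complex.I * a * t * oscIntegrand V t a R j (m + 2) x)
      (volume.restrict (Ioi 0)) := i12.add i3
  have h := integral_Ioi_of_hasDerivAt_of_tendsto hcont
    (fun x hx => hasDerivAt_oscIntegrand hV t a R j m hx) (i123.sub i4) htop
  rw [integral_sub i123 i4, integral_add i12 i3, integral_sub i1 i2,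
    integral_const_mul, integral_const_mul, integral_const_mul, h0, sub_zero] at h
  exact (sub_eq_zero.1 h).symm

lemma exists_norm_integral_oscIntegrand_le_pow {V : ℝ → ℂ}
    (hV : ContDiff ℝ (⊤ : ℕ∞) V) (hcs : HasCompactSupport V)
    (hsupp : Function.support V ⊆ Ioi 0)
    (hder : ∀ j : ℕ, ∃ Cj : ℝ, ∀ x : ℝ, ‖iteratedDeriv j V x‖ ≤ Cj) (b : ℝ) (k : ℕ) :
    ∀ j m : ℕ, ∃ C : ℝ, 0 ≤ C ∧ ∀ t a R : ℝ, 1 ≤ t → |a| ≤ b → R ≠ 0 →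
      ‖∫ x in Ioi 0, oscIntegrand V t a R j m x‖ ≤ C * (t / |R|) ^ k := by
  induction k with
  | zero =>
    intro j m
    obtain ⟨C, hC0, hC⟩ :=
      exists_integrableOn_and_norm_integral_oscIntegrand_le hV hcs hsupp hder j m
    exact ⟨C, hC0, fun t a R _ _ _ => by simpa using (hC t a R).2⟩
  | succ k ih =>
    intro j m
    obtain ⟨C₁, h₁, H₁⟩ := ih (j + 1) m
    obtain ⟨C₂, h₂, H₂⟩ := ih j (m + 1)
    obtain ⟨C₃, h₃, H₃⟩ := ih j (m + 2)
    refine ⟨C₁ + (m + 1) * C₂ + 2 * Real.pi * |b| * C₃, by positivity, fun t a R ht ha hR => ?_⟩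
    have H := congrArg norm (integral_oscIntegrand_by_parts hV hcs hsupp hder t a R j m)
    specialize H₁ t a R ht ha hR
    specialize H₂ t a R ht ha hR
    specialize H₃ t a R ht ha hR
    have hR' : 0 < |R| := abs_pos.2 hR
    have ht0 : 0 < t := by linarith
    have hpi : 1 ≤ 2 * Real.pi := by linarith [Real.two_le_pi]
    have hab : |a| ≤ |b| := ha.trans (le_abs_self b)
    set q := (t / |R|) ^ k with hq
    have hq0 : 0 ≤ q := by positivity
    have hm : ‖(m + Complex.I * t : ℂ)‖ ≤ (m + 1) * t := by
      refine (norm_add_le _ _).trans ?_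
      rw [norm_mul, Complex.norm_I, one_mul, Complex.norm_natCast, Complex.norm_real,
        Real.norm_of_nonneg ht0.le]
      nlinarith [(Nat.cast_nonneg m : (0 : ℝ) ≤ m)]
    have ha' : ‖(2 * Real.pi * Complex.I * a * t : ℂ)‖ ≤ 2 * Real.pi * |b| * t := by
      have : ‖(2 * Real.pi * Complex.I * a * t : ℂ)‖ = 2 * Real.pi * |a| * t := by
        simp [abs_of_pos Real.pi_pos, abs_of_pos ht0]
      rw [this]
      gcongr
    have hl : ‖(2 * Real.pi * Complex.I * R : ℂ)‖ = 2 * Real.pi * |R| := by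
      simp [abs_of_pos Real.pi_pos]
    rw [norm_mul, hl] at H
    have hbound : |R| * ‖∫ x in Ioi 0, oscIntegrand V t a R j m x‖
        ≤ (C₁ + (m + 1) * C₂ + 2 * Real.pi * |b| * C₃) * (t * q) := by
      calc |R| * ‖∫ x in Ioi 0, oscIntegrand V t a R j m x‖
          ≤ 2 * Real.pi * |R| * ‖∫ x in Ioi 0, oscIntegrand V t a R j m x‖ := by
            gcongr
            exact le_mul_of_one_le_left hR'.le hpi
        _ ≤ C₁ * q + (m + 1) * t * (C₂ * q) + 2 * Real.pi * |b| * t * (C₃ * q) := by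
            rw [H]
            refine (norm_add_le _ _).trans (add_le_add ((norm_sub_le _ _).trans ?_) ?_)
            · rw [norm_mul]
              gcongr
            · rw [norm_mul]
              gcongr
        _ ≤ C₁ * (t * q) + (m + 1) * t * (C₂ * q) + 2 * Real.pi * |b| * t * (C₃ * q) := by
            gcongr
            exact le_mul_of_one_le_left hq0 ht
        _ = _ := by ring
    rw [pow_succ, ← hq]
    rw [← le_div_iff₀' hR'] at hbound
    refine hbound.trans_eq ?_
    ring

/-- **integration-by-parts truncation.** Let `V` be smooth, compactly
supported in `(0,∞)`, with all derivatives bounded. For every `ε > 0` and `A ≥ 1` there is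
`C = C(A,ε,V)` such that for all `t ≥ 2`, `N, M ≥ 1`, positive integers `p, ℓ`, positive
integers `n ≤ 2N`, and nonzero integers `r` with `|r| ≥ t^ε M²t²ℓ/(Np)`:
`|∫ x^{−it} e(−nt/(Nx)) V(x) e(−rNpx/(M²ℓt)) dx| ≤ C t^{−A}`. -/
theorem statement10 (V : ℝ → ℂ) (hVsm : ContDiff ℝ (⊤ : ℕ∞) V) (hVcs : HasCompactSupport V)
    (hVsupp : Function.support V ⊆ Set.Ioi 0)
    (hVder : ∀ j : ℕ, ∃ Cj : ℝ, ∀ x : ℝ, ‖iteratedDeriv j V x‖ ≤ Cj) :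
    ∀ ε : ℝ, 0 < ε → ∀ A : ℝ, 1 ≤ A → ∃ C : ℝ, 0 < C ∧
      ∀ t : ℝ, 2 ≤ t → ∀ N M : ℝ, 1 ≤ N → 1 ≤ M →
        ∀ p ℓ : ℕ, 0 < p → 0 < ℓ → ∀ n : ℕ, 0 < n → (n : ℝ) ≤ 2 * N →
          ∀ r : ℤ, r ≠ 0 →
            t ^ ε * M ^ 2 * t ^ 2 * ℓ / (N * p) ≤ |(r : ℝ)| →
            ‖∫ x : ℝ, nit x t * e (-((n : ℝ) * t) / (N * x)) * V x *
                e (-((r : ℝ) * N * p * x) / (M ^ 2 * ℓ * t))‖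
              ≤ C * t ^ (-A) := by
  intro ε hε A _
  obtain ⟨k, hk⟩ := exists_nat_ge (A / ε)
  obtain ⟨C, hC0, hC⟩ := exists_norm_integral_oscIntegrand_le_pow hVsm hVcs hVsupp hVder 2 k 0 0
  refine ⟨C + 1, by positivity, fun t ht N M hN hM p ℓ hp hℓ n hn hnN r hr hrt => ?_⟩
  have ht0 : 0 < t := by linarith
  have hN0 : 0 < N := by linarith
  have hM0 : 0 < M := by linarith
  have hp0 : (0 : ℝ) < p := by exact_mod_cast hp
  have hℓ0 : (0 : ℝ) < ℓ := by exact_mod_cast hℓ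
  have hr0 : (r : ℝ) ≠ 0 := by exact_mod_cast hr
  set R : ℝ := r * N * p / (M ^ 2 * ℓ * t) with hRdef
  have hR : R ≠ 0 := by positivity
  have habs : |R| = |(r : ℝ)| * N * p / (M ^ 2 * ℓ * t) := by
    rw [hRdef, abs_div, abs_mul, abs_mul, abs_of_pos hN0, abs_of_pos hp0,
      abs_of_pos (show 0 < M ^ 2 * ℓ * t by positivity)]
  have hRt : t / |R| ≤ t ^ (-ε) := by
    rw [div_le_iff₀ (abs_pos.2 hR), habs, Real.rpow_neg ht0.le, ← div_eq_inv_mul,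
      le_div_iff₀ (by positivity), le_div_iff₀ (by positivity)]
    rw [div_le_iff₀ (by positivity)] at hrt
    nlinarith [hrt]
  have ha : |(n : ℝ) / N| ≤ 2 := by
    rw [abs_of_nonneg (by positivity), div_le_iff₀ hN0]
    exact hnN
  have hint : (∫ x : ℝ, nit x t * e (-((n : ℝ) * t) / (N * x)) * V x *
      e (-((r : ℝ) * N * p * x) / (M ^ 2 * ℓ * t)))
      = ∫ x in Ioi 0, oscIntegrand V t (n / N) R 0 0 x := by
    rw [← setIntegral_eq_integral_of_forall_compl_eq_zero (s := Ioi 0)]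
    · refine setIntegral_congr_fun measurableSet_Ioi fun x hx => ?_
      have hx0 : x ≠ 0 := (mem_Ioi.1 hx).ne'
      have e1 : -((n : ℝ) * t) / (N * x) = -(n / N * t) / x := by field_simp
      have e2 : -((r : ℝ) * N * p * x) / (M ^ 2 * ℓ * t) = -(R * x) := by
        rw [hRdef]; ring
      simp only [oscIntegrand, oscFactor, iteratedDeriv_zero, pow_zero, mul_one, e1, e2]
      ring
    · intro x hx
      have : V x = 0 := by
        by_contra h
        exact hx (hVsupp h)
      simp [this]
  rw [hint]
  calc _ ≤ C * (t / |R|) ^ k := hC t (n / N) R (by linarith) ha hR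
    _ ≤ C * (t ^ (-ε)) ^ k := by gcongr
    _ = C * t ^ (-ε * k) := by rw [Real.rpow_mul ht0.le, Real.rpow_natCast]
    _ ≤ (C + 1) * t ^ (-A) := by
      have hA : A ≤ k * ε := (div_le_iff₀ hε).1 hk
      have : t ^ (-ε * k) ≤ t ^ (-A) :=
        Real.rpow_le_rpow_of_exponent_le (by linarith) (by nlinarith)
      gcongr
      linarith
end

section
/- For every ε > 0 there exists a constant C_ε > 0 such that for all reals L, X ≥ 1, the sum over integers ℓ₁, ℓ₂ ∈ [L,2L] and integers m₁, m₂ ∈ [X,2X] with ℓ₁ m₂ ≠ ℓ₂ m₁, of 1/|ℓ₁ m₂ − ℓ₂ m₁|, is at most C_ε ( (LX)^{1+ε} + L^{2+ε} ). -/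
/-- A two-sided harmonic sum is at most `2 (1 + log N)`. -/
lemma sum_Icc_neg_one_div_abs_le (N : ℕ) :
    ∑ k ∈ Finset.Icc (-N : ℤ) N, 1 / |(k : ℝ)| ≤ 2 * (1 + Real.log N) := by
  rw [Finset.sum_Icc_of_even_eq_range (f := fun k : ℤ ↦ 1 / |(k : ℝ)|)
    (fun k ↦ by simp), Finset.sum_range_succ']
  have h := harmonic_le_one_add_log N
  simp only [harmonic, Rat.cast_sum, Rat.cast_inv, Rat.cast_natCast] at h
  have heq : ∑ k ∈ Finset.range N, 1 / |(((k + 1 : ℕ) : ℤ) : ℝ)| =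
      ∑ k ∈ Finset.range N, (((k + 1 : ℕ) : ℝ))⁻¹ :=
    Finset.sum_congr rfl fun k _ ↦ by
      rw [Int.cast_natCast, Nat.abs_cast, one_div]
  rw [heq]
  simp only [Nat.cast_zero, Int.cast_zero, abs_zero, div_zero, add_zero, sub_zero, nsmul_eq_mul,
    Nat.cast_ofNat]
  linarith

/-- A pair `(c, d)` is determined by the value of `a * d - c * b` and by which of the blocks of
length `a / gcd a b` starting at `u` contains `c`. -/
lemma eq_of_linear_form_eq_of_block_eq {a b c d c' d' u : ℕ} (ha : 0 < a) (hc : u ≤ c)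
    (hc' : u ≤ c')
    (hform : (a * d - c * b : ℤ) = a * d' - c' * b)
    (hblock : (c - u) / (a / a.gcd b) = (c' - u) / (a / a.gcd b)) :
    c = c' ∧ d = d' := by
  have hg : 0 < a.gcd b := Nat.gcd_pos_of_pos_left _ ha
  obtain ⟨q, r, hqr, hq, hr⟩ := Nat.exists_coprime a b
  have haq : a / a.gcd b = q := Nat.div_eq_of_eq_mul_left hg hq
  rw [haq] at hblock
  generalize a.gcd b = g at hg hq hr
  have hgz : (g : ℤ) ≠ 0 := by exact_mod_cast hg.ne'
  have hred : (q : ℤ) * (d - d') = r * (c - c') := by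
    apply mul_left_cancel₀ hgz
    rw [hq, hr] at hform
    push_cast at hform
    linear_combination hform
  have hdvd : (q : ℤ) ∣ c - c' :=
    (Nat.isCoprime_iff_coprime.mpr hqr).dvd_of_dvd_mul_left ⟨_, hred.symm⟩
  have hmod : (c - u) % q = (c' - u) % q := by
    have : (c - u) ≡ (c' - u) [MOD q] := by
      rw [Nat.modEq_iff_dvd]
      push_cast [hc, hc']
      rw [← Int.dvd_neg]
      convert hdvd using 1
      ring
    exact this
  have hcu : c - u = c' - u := by
    rw [← Nat.div_add_mod (c - u) q, ← Nat.div_add_mod (c' - u) q, hblock, hmod]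
  have hcc : c = c' := by omega
  refine ⟨hcc, ?_⟩
  have haz : (a : ℤ) ≠ 0 := by exact_mod_cast ha.ne'
  subst hcc
  have : (a : ℤ) * d = a * d' := by linarith
  exact_mod_cast mul_left_cancel₀ haz this

/-- For fixed `a` and `b`, the reciprocals of `|a * d - c * b|`, with `c` in an interval of length
at most `a`, sum to at most four times a harmonic sum. -/
lemma sum_one_div_abs_linear_form_le {a b u v N : ℕ} {D : Finset ℕ} (ha : 0 < a)
    (huv : v ≤ u + a)
    (hN : ∀ c ∈ Finset.Icc u v, ∀ d ∈ D, |(a * d - c * b : ℤ)| ≤ N) :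
    ∑ c ∈ Finset.Icc u v, ∑ d ∈ D, 1 / |(a * d : ℝ) - c * b| ≤ 4 * (1 + Real.log N) := by
  set g := a.gcd b
  have hg : 0 < g := Nat.gcd_pos_of_pos_left _ ha
  have hgz : (g : ℤ) ≠ 0 := by exact_mod_cast hg.ne'
  have hga : g ∣ a := Nat.gcd_dvd_left a b
  have hdvd : ∀ c d : ℕ, (g : ℤ) ∣ a * d - c * b := fun c d ↦
    dvd_sub (Dvd.dvd.mul_right (by exact_mod_cast hga) _)
      (Dvd.dvd.mul_left (by exact_mod_cast Nat.gcd_dvd_right a b) _)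
  let φ : ℕ × ℕ → ℕ × ℤ := fun p ↦ ((p.1 - u) / (a / g), (a * p.2 - p.1 * b : ℤ) / g)
  let f : ℕ × ℤ → ℝ := fun p ↦ 1 / (g * |(p.2 : ℝ)|)
  have hinj : Set.InjOn φ (Finset.Icc u v ×ˢ D : Finset (ℕ × ℕ)) := by
    rintro ⟨c, d⟩ h ⟨c', d'⟩ h' heq
    simp only [Finset.coe_product, Set.mem_prod, Finset.mem_coe, Finset.mem_Icc] at h h'
    simp only [φ, Prod.mk.injEq] at heq
    have hform := (Int.ediv_left_inj (hdvd c d) (hdvd c' d')).mp heq.2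
    have := eq_of_linear_form_eq_of_block_eq ha h.1.1 h'.1.1 hform heq.1
    simp [this]
  have hmaps : (Finset.Icc u v ×ˢ D).image φ ⊆
      Finset.range (g + 1) ×ˢ Finset.Icc (-N : ℤ) N := by
    rw [Finset.image_subset_iff]
    rintro ⟨c, d⟩ h
    rw [Finset.mem_product] at h
    have hb := hN c h.1 d h.2
    have hc := Finset.mem_Icc.mp h.1
    simp only [φ, Finset.mem_product, Finset.mem_range, Finset.mem_Icc]
    constructor
    · have hle : (c - u) / (a / g) ≤ a / (a / g) := Nat.div_le_div_right (by omega)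
      rw [Nat.div_div_self hga ha.ne'] at hle
      omega
    · rw [← abs_le]
      obtain ⟨k, hk⟩ := hdvd c d
      rw [hk] at hb ⊢
      rw [Int.mul_ediv_cancel_left _ hgz]
      rw [abs_mul, Nat.abs_cast] at hb
      have h1 : (1 : ℤ) ≤ g := by exact_mod_cast hg
      nlinarith [abs_nonneg k]
  have hval : ∀ p : ℕ × ℕ, 1 / |(a * p.2 : ℝ) - p.1 * b| = f (φ p) := by
    rintro ⟨c, d⟩
    obtain ⟨k, hk⟩ := hdvd c d
    have hk' : (a * d : ℝ) - c * b = g * k := by exact_mod_cast hk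
    simp only [f, φ]
    rw [hk, Int.mul_ediv_cancel_left _ hgz, hk', abs_mul, Nat.abs_cast]
  have hlog : 0 ≤ 1 + Real.log N := by
    have := Real.log_natCast_nonneg N
    linarith
  have hgR : (1 : ℝ) ≤ g := by exact_mod_cast hg
  calc ∑ c ∈ Finset.Icc u v, ∑ d ∈ D, 1 / |(a * d : ℝ) - c * b|
      = ∑ p ∈ Finset.Icc u v ×ˢ D, f (φ p) := by
        rw [← Finset.sum_product']
        exact Finset.sum_congr rfl fun p _ ↦ hval p
    _ = ∑ q ∈ (Finset.Icc u v ×ˢ D).image φ, f q := (Finset.sum_image hinj).symm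
    _ ≤ ∑ q ∈ Finset.range (g + 1) ×ˢ Finset.Icc (-N : ℤ) N, f q :=
        Finset.sum_le_sum_of_subset_of_nonneg hmaps fun q _ _ ↦ by positivity
    _ = (g + 1) / g * ∑ k ∈ Finset.Icc (-N : ℤ) N, 1 / |(k : ℝ)| := by
        rw [Finset.sum_product]
        simp only [f, Finset.sum_const, Finset.card_range, nsmul_eq_mul, one_div, mul_inv,
          ← Finset.mul_sum]
        push_cast
        ring
    _ ≤ 2 * (2 * (1 + Real.log N)) := by
        gcongr
        · rw [div_le_iff₀ (by linarith)]
          linarith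
        · exact sum_Icc_neg_one_div_abs_le N
    _ = 4 * (1 + Real.log N) := by ring

lemma card_Icc_ceil_floor_le {L : ℝ} (hL : 1 ≤ L) :
    ((Finset.Icc ⌈L⌉₊ ⌊2 * L⌋₊).card : ℝ) ≤ 2 * L := by
  have h1 : 1 ≤ ⌈L⌉₊ := Nat.one_le_ceil_iff.mpr (by linarith)
  rw [Nat.card_Icc]
  calc ((⌊2 * L⌋₊ + 1 - ⌈L⌉₊ : ℕ) : ℝ) ≤ (⌊2 * L⌋₊ : ℕ) := by
        exact_mod_cast (by omega)
    _ ≤ 2 * L := Nat.floor_le (by linarith)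

lemma mem_Icc_ceil_floor {L : ℝ} (hL : 1 ≤ L) {n : ℕ} :
    n ∈ Finset.Icc ⌈L⌉₊ ⌊2 * L⌋₊ ↔ L ≤ n ∧ (n : ℝ) ≤ 2 * L := by
  rw [Finset.mem_Icc, Nat.ceil_le, Nat.le_floor_iff (by linarith)]

lemma one_add_log_four_mul_le {ε x : ℝ} (hε : 0 < ε) (hx : 1 ≤ x) :
    1 + Real.log (4 * x) ≤ (4 + 1 / ε) * x ^ ε := by
  have h4 : Real.log 4 ≤ 3 := by
    have := Real.log_le_sub_one_of_pos (show (0 : ℝ) < 4 by norm_num)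
    linarith
  have hlog := Real.log_le_rpow_div (show 0 ≤ x by linarith) hε
  have hone := Real.one_le_rpow hx hε.le
  rw [Real.log_mul (by norm_num) (by linarith), add_mul, one_div_mul_eq_div]
  linarith


/-- For every `ε > 0` there is `C_ε > 0` such that for all reals `L, X ≥ 1`,
the sum over integers `ℓ₁, ℓ₂ ∈ [L,2L]` and `m₁, m₂ ∈ [X,2X]` with `ℓ₁ m₂ ≠ ℓ₂ m₁` of
`1/|ℓ₁ m₂ − ℓ₂ m₁|` is at most `C_ε ((LX)^{1+ε} + L^{2+ε})`. -/
theorem statement12 :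
    ∀ ε : ℝ, 0 < ε → ∃ C : ℝ, 0 < C ∧
      ∀ L X : ℝ, 1 ≤ L → 1 ≤ X →
        (∑ ℓ₁ ∈ Finset.Icc ⌈L⌉₊ ⌊2 * L⌋₊,
         ∑ ℓ₂ ∈ Finset.Icc ⌈L⌉₊ ⌊2 * L⌋₊,
         ∑ m₁ ∈ Finset.Icc ⌈X⌉₊ ⌊2 * X⌋₊,
         ∑ m₂ ∈ Finset.Icc ⌈X⌉₊ ⌊2 * X⌋₊,
           if ℓ₁ * m₂ = ℓ₂ * m₁ then (0 : ℝ)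
           else 1 / |(ℓ₁ * m₂ : ℝ) - (ℓ₂ * m₁ : ℝ)|)
        ≤ C * ((L * X) ^ (1 + ε) + L ^ (2 + ε)) := by
  intro ε hε
  refine ⟨16 * (4 + 1 / ε), by positivity, fun L X hL hX ↦ ?_⟩
  have hLX : 1 ≤ L * X := one_le_mul_of_one_le_of_one_le hL hX
  have hinner : ∀ a ∈ Finset.Icc ⌈L⌉₊ ⌊2 * L⌋₊, ∀ b ∈ Finset.Icc ⌈X⌉₊ ⌊2 * X⌋₊,
      ∑ c ∈ Finset.Icc ⌈L⌉₊ ⌊2 * L⌋₊, ∑ d ∈ Finset.Icc ⌈X⌉₊ ⌊2 * X⌋₊,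
        1 / |(a * d : ℝ) - c * b| ≤ 4 * ((4 + 1 / ε) * (L * X) ^ ε) := by
    intro a ha b hb
    have ha' := (mem_Icc_ceil_floor hL).mp ha
    have hb' := (mem_Icc_ceil_floor hX).mp hb
    have hpos : 0 < a := by
      have : (0 : ℝ) < a := by linarith
      exact_mod_cast this
    have hlen : ⌊2 * L⌋₊ ≤ ⌈L⌉₊ + a := by
      have h1 := Nat.floor_le (show 0 ≤ 2 * L by linarith)
      have h2 := Nat.le_ceil L
      have : (⌊2 * L⌋₊ : ℝ) ≤ ⌈L⌉₊ + a := by linarith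
      exact_mod_cast this
    have hN : ∀ c ∈ Finset.Icc ⌈L⌉₊ ⌊2 * L⌋₊, ∀ d ∈ Finset.Icc ⌈X⌉₊ ⌊2 * X⌋₊,
        |(a * d - c * b : ℤ)| ≤ (⌊4 * (L * X)⌋₊ : ℕ) := by
      intro c hc d hd
      have hc' := (mem_Icc_ceil_floor hL).mp hc
      have hd' := (mem_Icc_ceil_floor hX).mp hd
      have had : a * d ≤ ⌊4 * (L * X)⌋₊ := by
        apply Nat.le_floor
        push_cast
        calc (a * d : ℝ) ≤ (2 * L) * (2 * X) := by gcongr <;> linarith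
          _ = 4 * (L * X) := by ring
      have hcb : c * b ≤ ⌊4 * (L * X)⌋₊ := by
        apply Nat.le_floor
        push_cast
        calc (c * b : ℝ) ≤ (2 * L) * (2 * X) := by gcongr <;> linarith
          _ = 4 * (L * X) := by ring
      zify at had hcb
      rw [abs_le]
      constructor <;> nlinarith [Int.natCast_nonneg (a * d), Int.natCast_nonneg (c * b)]
    refine (sum_one_div_abs_linear_form_le hpos hlen hN).trans ?_
    gcongr
    refine le_trans ?_ (one_add_log_four_mul_le hε hLX)
    have hfl : 0 < ⌊4 * (L * X)⌋₊ := Nat.floor_pos.mpr (by linarith)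
    gcongr
    exact Nat.floor_le (by linarith)
  have hif : ∀ a c b d : ℕ, (if a * d = c * b then (0 : ℝ)
      else 1 / |(a * d : ℝ) - (c * b : ℝ)|) = 1 / |(a * d : ℝ) - c * b| := by
    intro a c b d
    split_ifs with h
    · have h' : (a * d : ℝ) = c * b := by exact_mod_cast h
      simp [h']
    · rfl
  simp only [hif]
  have hM : 0 ≤ 4 * ((4 + 1 / ε) * (L * X) ^ ε) := by positivity
  calc _ = ∑ a ∈ Finset.Icc ⌈L⌉₊ ⌊2 * L⌋₊, ∑ b ∈ Finset.Icc ⌈X⌉₊ ⌊2 * X⌋₊,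
        ∑ c ∈ Finset.Icc ⌈L⌉₊ ⌊2 * L⌋₊, ∑ d ∈ Finset.Icc ⌈X⌉₊ ⌊2 * X⌋₊,
          1 / |(a * d : ℝ) - c * b| := Finset.sum_congr rfl fun a _ ↦ Finset.sum_comm
    _ ≤ ∑ a ∈ Finset.Icc ⌈L⌉₊ ⌊2 * L⌋₊, ∑ b ∈ Finset.Icc ⌈X⌉₊ ⌊2 * X⌋₊,
          4 * ((4 + 1 / ε) * (L * X) ^ ε) :=
        Finset.sum_le_sum fun a ha ↦ Finset.sum_le_sum fun b hb ↦ hinner a ha b hb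
    _ = (Finset.Icc ⌈L⌉₊ ⌊2 * L⌋₊).card * ((Finset.Icc ⌈X⌉₊ ⌊2 * X⌋₊).card *
          (4 * ((4 + 1 / ε) * (L * X) ^ ε))) := by
        simp only [Finset.sum_const, nsmul_eq_mul]
    _ ≤ (2 * L) * ((2 * X) * (4 * ((4 + 1 / ε) * (L * X) ^ ε))) := by
        gcongr
        · exact card_Icc_ceil_floor_le hL
        · exact card_Icc_ceil_floor_le hX
    _ = 16 * (4 + 1 / ε) * (L * X) ^ (1 + ε) := by
        rw [Real.rpow_add (by linarith), Real.rpow_one]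
        ring
    _ ≤ 16 * (4 + 1 / ε) * ((L * X) ^ (1 + ε) + L ^ (2 + ε)) := by
        gcongr
        have : 0 ≤ L ^ (2 + ε) := by positivity
        linarith
end

section
/- Let ℓ₁ ≠ ℓ₂ be distinct prime numbers, let q be a positive integer with ℓ₁ ∤ q and ℓ₂ ∤ q, and let u₁, u₂ be integers. Then ∑_{a mod ℓ₁ℓ₂q} S(u₁, a; ℓ₁q) S(u₂, a; ℓ₂q) = 0. -/
open Complex

/-- The Kloosterman sum `S(a,b;c) = ∑_{x mod c, (x,c)=1} e((ax + b x̄)/c)`. -/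
noncomputable def klo (a b : ℤ) (c : ℕ) : ℂ :=
  ∑ x ∈ Finset.range c, if Nat.gcd x c = 1 then
    e (((a * x + b * ((((x : ZMod c))⁻¹).val : ℤ) : ℤ) : ℝ) / (c : ℝ))
  else 0

lemma e_add (x y : ℝ) : e (x + y) = e x * e y := by
  simp only [e, ← Complex.exp_add]
  push_cast
  ring_nf

lemma e_nat_mul (n : ℕ) (x : ℝ) : e (n * x) = e x ^ n := by
  simp only [e, ← Complex.exp_nat_mul]
  push_cast
  ring_nf

lemma e_eq_one_iff (x : ℝ) : e x = 1 ↔ ∃ n : ℤ, x = n := by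
  rw [e, Complex.exp_eq_one_iff]
  refine exists_congr fun n => ?_
  rw [mul_comm, mul_left_inj' Complex.two_pi_I_ne_zero]
  norm_cast

/-- Orthogonality of additive characters modulo `N`, for a nontrivial frequency. -/
lemma sum_e_mul_div_eq_zero {N : ℕ} (hN : N ≠ 0) {m : ℤ} (hm : ¬ (N : ℤ) ∣ m) :
    ∑ a ∈ Finset.range N, e (a * ((m : ℝ) / N)) = 0 := by
  have hN' : (N : ℝ) ≠ 0 := by exact_mod_cast hN
  have hne : e ((m : ℝ) / N) ≠ 1 := by
    rw [Ne, e_eq_one_iff]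
    rintro ⟨n, hn⟩
    rw [div_eq_iff hN'] at hn
    exact hm ⟨n, by rw [mul_comm]; exact_mod_cast hn⟩
  have hpow : e ((m : ℝ) / N) ^ N = 1 := by
    rw [← e_nat_mul, mul_div_cancel₀ _ hN', e_eq_one_iff]
    exact ⟨m, rfl⟩
  simp only [e_nat_mul]
  rw [geom_sum_eq hne, hpow, sub_self, zero_div]

lemma coprime_val_inv {x c : ℕ} (h : x.Coprime c) : ((x : ZMod c)⁻¹).val.Coprime c := by
  rw [← ZMod.coe_unitOfCoprime x h, ZMod.inv_coe_unit]
  exact ZMod.val_coe_unit_coprime _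

/-- Let `ℓ₁ ≠ ℓ₂` be distinct primes, `q` a positive integer not divisible
by `ℓ₁` nor `ℓ₂`, and `u₁, u₂` integers. Then
`∑_{a mod ℓ₁ℓ₂q} S(u₁, a; ℓ₁q) S(u₂, a; ℓ₂q) = 0`. -/
theorem statement14 (ℓ₁ ℓ₂ : ℕ) (hℓ₁ : Nat.Prime ℓ₁) (hℓ₂ : Nat.Prime ℓ₂) (hne : ℓ₁ ≠ ℓ₂)
    (q : ℕ) (hq : 0 < q) (h₁ : ¬ ℓ₁ ∣ q) (h₂ : ¬ ℓ₂ ∣ q) (u₁ u₂ : ℤ) :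
    ∑ a ∈ Finset.range (ℓ₁ * ℓ₂ * q), klo u₁ (a : ℤ) (ℓ₁ * q) * klo u₂ (a : ℤ) (ℓ₂ * q) = 0 := by
  have hN : ℓ₁ * ℓ₂ * q ≠ 0 := mul_ne_zero (mul_ne_zero hℓ₁.ne_zero hℓ₂.ne_zero) hq.ne'
  simp only [klo, Finset.sum_mul_sum]
  rw [Finset.sum_comm]
  refine Finset.sum_eq_zero fun x _ => ?_
  rw [Finset.sum_comm]
  refine Finset.sum_eq_zero fun y _ => ?_
  by_cases hx : Nat.gcd x (ℓ₁ * q) = 1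
  swap
  · simp [hx]
  by_cases hy : Nat.gcd y (ℓ₂ * q) = 1
  swap
  · simp [hy]
  simp only [if_pos hx, if_pos hy]
  have hX := coprime_val_inv hx
  generalize ((x : ZMod (ℓ₁ * q))⁻¹).val = X at hX ⊢
  generalize ((y : ZMod (ℓ₂ * q))⁻¹).val = Y
  have hm : ¬ ((ℓ₁ * ℓ₂ * q : ℕ) : ℤ) ∣ ((X * ℓ₂ + Y * ℓ₁ : ℕ) : ℤ) := by
    rw [Int.natCast_dvd_natCast]
    intro h
    have h' : ℓ₁ ∣ X * ℓ₂ + Y * ℓ₁ := (Dvd.intro _ (mul_assoc _ _ _).symm).trans h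
    rw [← Nat.dvd_add_iff_left (Dvd.intro_left _ rfl)] at h'
    rcases hℓ₁.dvd_mul.mp h' with h' | h'
    · exact Nat.not_coprime_of_dvd_of_dvd hℓ₁.one_lt h' (dvd_mul_right _ _) hX
    · exact hne ((Nat.prime_dvd_prime_iff_eq hℓ₁ hℓ₂).mp h')
  have key : ∀ a : ℕ,
      e (((u₁ * x + a * (X : ℤ) : ℤ) : ℝ) / ((ℓ₁ * q : ℕ) : ℝ)) *
        e (((u₂ * y + a * (Y : ℤ) : ℤ) : ℝ) / ((ℓ₂ * q : ℕ) : ℝ)) =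
      e ((u₁ * x : ℝ) / (ℓ₁ * q) + (u₂ * y : ℝ) / (ℓ₂ * q)) *
        e (a * ((((X * ℓ₂ + Y * ℓ₁ : ℕ) : ℤ) : ℝ) / (ℓ₁ * ℓ₂ * q : ℕ))) := by
    intro a
    have p₁ : (ℓ₁ : ℝ) ≠ 0 := by exact_mod_cast hℓ₁.ne_zero
    have p₂ : (ℓ₂ : ℝ) ≠ 0 := by exact_mod_cast hℓ₂.ne_zero
    have p₃ : (q : ℝ) ≠ 0 := by exact_mod_cast hq.ne'
    rw [← e_add, ← e_add]
    congr 1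
    push_cast
    field_simp
    ring
  rw [Finset.sum_congr rfl fun a _ => key a, ← Finset.mul_sum, sum_e_mul_div_eq_zero hN hm,
    mul_zero]
end
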